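/- arXiv:1712.06947 — 3 statements merged into one kernel-verified Lean document; each statement's English description precedes it below -/
import Mathlib

section
/- For each k ∈ {1,…,N}, the equilibrium expectation of A at inverse temperature β_k equals the parallel-tempering reweighted expectation: ∫_{ℝ^d} A(x) ρ_{β_k}(x) dx = Σ_{j=1}^N ∫_{(ℝ^d)^N} A(x_j) η_{j,k}(X) ϱ(X) dX. -/
open Real Equiv Finset MeasureTheory

/-- The permuted potential `𝒱(X,σ) = β⁻¹ ∑ᵢ β_{σ(i)} V(xᵢ)`, with reference
inverse temperature `β = β 0`. -/
noncomputable def permPotential (d N : ℕ) [NeZero N] (V : (Fin d → ℝ) → ℝ) (β : Fin N → ℝ)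
    (X : Fin N → Fin d → ℝ) (σ : Equiv.Perm (Fin N)) : ℝ :=
  (β 0)⁻¹ * ∑ i : Fin N, β (σ i) * V (X i)

/-- The conditional permutation weights `ϱ(σ∣X)`. -/
noncomputable def condWeight (d N : ℕ) [NeZero N] (V : (Fin d → ℝ) → ℝ) (β : Fin N → ℝ)
    (σ : Equiv.Perm (Fin N)) (X : Fin N → Fin d → ℝ) : ℝ :=
  Real.exp (-(β 0) * permPotential d N V β X σ) /
    ∑ σ' : Equiv.Perm (Fin N), Real.exp (-(β 0) * permPotential d N V β X σ')

/-- The occupation probabilities `η_{j,k}(X) = ∑_σ 1_{σ(j)=k} ϱ(σ∣X)`. -/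
noncomputable def occProb (d N : ℕ) [NeZero N] (V : (Fin d → ℝ) → ℝ) (β : Fin N → ℝ)
    (j k : Fin N) (X : Fin N → Fin d → ℝ) : ℝ :=
  ∑ σ : Equiv.Perm (Fin N), (if σ j = k then (1:ℝ) else 0) * condWeight d N V β σ X

/-- Partition function `Z_{β_i} = ∫ e^{−β_i V}`. -/
noncomputable def partZ (d N : ℕ) (V : (Fin d → ℝ) → ℝ) (β : Fin N → ℝ) (i : Fin N) : ℝ :=
  ∫ x : Fin d → ℝ, Real.exp (-(β i) * V x)

/-- Single-replica Boltzmann density `ρ_{β_i}(x) = Z_{β_i}⁻¹ e^{−β_i V(x)}`. -/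
noncomputable def boltz (d N : ℕ) (V : (Fin d → ℝ) → ℝ) (β : Fin N → ℝ)
    (i : Fin N) (x : Fin d → ℝ) : ℝ :=
  (partZ d N V β i)⁻¹ * Real.exp (-(β i) * V x)

/-- The joint density `ϱ(X,σ) = (N!)⁻¹ ∏ᵢ ρ_{β_{σ(i)}}(xᵢ)`. -/
noncomputable def jointDensity (d N : ℕ) (V : (Fin d → ℝ) → ℝ) (β : Fin N → ℝ)
    (X : Fin N → Fin d → ℝ) (σ : Equiv.Perm (Fin N)) : ℝ :=
  ((N.factorial : ℝ))⁻¹ * ∏ i : Fin N, boltz d N V β (σ i) (X i)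

/-- The marginal density `ϱ(X) = ∑_σ ϱ(X,σ)`. -/
noncomputable def margDensity (d N : ℕ) (V : (Fin d → ℝ) → ℝ) (β : Fin N → ℝ)
    (X : Fin N → Fin d → ℝ) : ℝ :=
  ∑ σ : Equiv.Perm (Fin N), jointDensity d N V β X σ

theorem jointDensity_eq_mul_exp (d N : ℕ) [NeZero N] (V : (Fin d → ℝ) → ℝ) (β : Fin N → ℝ)
    (h0 : β 0 ≠ 0) (X : Fin N → Fin d → ℝ) (σ : Equiv.Perm (Fin N)) :
    jointDensity d N V β X σ = ((N.factorial : ℝ)⁻¹ * ∏ i : Fin N, (partZ d N V β i)⁻¹) *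
      Real.exp (-(β 0) * permPotential d N V β X σ) := by
  have h : -(β 0) * permPotential d N V β X σ = ∑ i : Fin N, -(β (σ i)) * V (X i) := by
    simp only [permPotential, neg_mul, Finset.sum_neg_distrib, mul_inv_cancel_left₀ h0]
  simp only [jointDensity, boltz, Finset.prod_mul_distrib]
  rw [h, Real.exp_sum, Equiv.prod_comp σ (fun i => (partZ d N V β i)⁻¹), mul_assoc]

theorem condWeight_mul_margDensity (d N : ℕ) [NeZero N] (V : (Fin d → ℝ) → ℝ) (β : Fin N → ℝ)
    (h0 : β 0 ≠ 0) (X : Fin N → Fin d → ℝ) (σ : Equiv.Perm (Fin N)) :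
    condWeight d N V β σ X * margDensity d N V β X = jointDensity d N V β X σ := by
  have hpos : 0 < ∑ σ' : Equiv.Perm (Fin N), Real.exp (-(β 0) * permPotential d N V β X σ') :=
    Finset.sum_pos (fun _ _ => Real.exp_pos _) Finset.univ_nonempty
  simp only [condWeight, margDensity, jointDensity_eq_mul_exp d N V β h0, ← Finset.mul_sum]
  field_simp

theorem occProb_mul_margDensity (d N : ℕ) [NeZero N] (V : (Fin d → ℝ) → ℝ) (β : Fin N → ℝ)
    (h0 : β 0 ≠ 0) (j k : Fin N) (X : Fin N → Fin d → ℝ) :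
    occProb d N V β j k X * margDensity d N V β X =
      ∑ σ : Equiv.Perm (Fin N), if σ j = k then jointDensity d N V β X σ else 0 := by
  simp only [occProb, Finset.sum_mul, condWeight_mul_margDensity d N V β h0, ite_mul,
    one_mul, zero_mul]

theorem integral_boltz (d N : ℕ) (V : (Fin d → ℝ) → ℝ) (β : Fin N → ℝ) (i : Fin N)
    (hZ : partZ d N V β i ≠ 0) : ∫ x, boltz d N V β i x = 1 := by
  simp only [boltz, integral_const_mul]
  exact inv_mul_cancel₀ hZ

theorem mul_prod_eq_prod_update {ι α : Type*} [Fintype ι] [DecidableEq ι] (f : ι → α → ℝ)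
    (A : α → ℝ) (j : ι) (X : ι → α) :
    A (X j) * ∏ i, f i (X i) = ∏ i, Function.update f j (fun x => A x * f j x) i (X i) := by
  rw [Fintype.prod_eq_mul_prod_compl j, Fintype.prod_eq_mul_prod_compl j, Function.update_self,
    mul_assoc]
  congr 2
  refine Finset.prod_congr rfl fun i hi => ?_
  rw [Function.update_of_ne (by simpa using hi)]

theorem integrable_mul_prod {ι α : Type*} [Fintype ι] [MeasureSpace α]
    [SigmaFinite (volume : Measure α)] (f : ι → α → ℝ) (A : α → ℝ) (j : ι)
    (hf : ∀ i, Integrable (f i)) (hA : Integrable fun x => A x * f j x) :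
    Integrable fun X : ι → α => A (X j) * ∏ i, f i (X i) := by
  classical
  simp only [mul_prod_eq_prod_update]
  refine Integrable.fintype_prod fun i => ?_
  obtain rfl | h := eq_or_ne i j
  · simpa using hA
  · simpa [h] using hf i

theorem integral_mul_prod {ι α : Type*} [Fintype ι] [MeasureSpace α]
    [SigmaFinite (volume : Measure α)] (f : ι → α → ℝ) (A : α → ℝ) (j : ι)
    (hf : ∀ i, ∫ x, f i x = 1) :
    ∫ X : ι → α, A (X j) * ∏ i, f i (X i) = ∫ x, A x * f j x := by
  classical
  simp only [mul_prod_eq_prod_update]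
  rw [integral_fintype_prod_volume_eq_prod, Fintype.prod_eq_single j, Function.update_self]
  intro i h
  rw [Function.update_of_ne h, hf]

/-- the equilibrium expectation of `A` at inverse temperature `β_k` equals
the parallel-tempering reweighted expectation:
`∫ A ρ_{β_k} = ∑_j ∫ A(x_j) η_{j,k}(X) ϱ(X) dX`. -/
theorem expectation_reweighting_identity
    (d N : ℕ) (hd : 1 ≤ d) [NeZero N]
    (V : (Fin d → ℝ) → ℝ) (hV : Measurable V)
    (β : Fin N → ℝ) (hβ : ∀ i, 0 < β i)
    (hZint : ∀ i, Integrable (fun x : Fin d → ℝ => Real.exp (-(β i) * V x)))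
    (hZpos : ∀ i, 0 < partZ d N V β i)
    (A : (Fin d → ℝ) → ℝ) (hA : Measurable A)
    (hA1 : ∀ i, Integrable (fun x : Fin d → ℝ => |A x| * Real.exp (-(β i) * V x))) :
    ∀ k : Fin N,
      (∫ x : Fin d → ℝ, A x * boltz d N V β k x)
        = ∑ j : Fin N, ∫ X : Fin N → Fin d → ℝ,
            A (X j) * occProb d N V β j k X * margDensity d N V β X := by
  intro k
  have h0 : β 0 ≠ 0 := (hβ 0).ne'
  have hb : ∀ i, Integrable (boltz d N V β i) := fun i => (hZint i).const_mul _
  have hAb : ∀ i, Integrable fun x => A x * boltz d N V β i x := by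
    intro i
    have h : Integrable fun x => A x * Real.exp (-(β i) * V x) := by
      refine (hA1 i).mono (by fun_prop) (ae_of_all _ fun x => ?_)
      simp
    refine (h.const_mul (partZ d N V β i)⁻¹).congr (ae_of_all _ fun x => ?_)
    simp only [boltz]
    ring
  have hterm : ∀ (j : Fin N) (σ : Equiv.Perm (Fin N)),
      Integrable fun X : Fin N → Fin d → ℝ => A (X j) * jointDensity d N V β X σ := by
    intro j σ
    simp only [jointDensity, mul_left_comm (A _)]
    exact (integrable_mul_prod (fun i => boltz d N V β (σ i)) A j (fun i => hb _)
      (hAb _)).const_mul _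
  have hval : ∀ (j : Fin N) (σ : Equiv.Perm (Fin N)),
      ∫ X : Fin N → Fin d → ℝ, A (X j) * jointDensity d N V β X σ =
        (N.factorial : ℝ)⁻¹ * ∫ x, A x * boltz d N V β (σ j) x := by
    intro j σ
    simp only [jointDensity, mul_left_comm (A _), integral_const_mul]
    rw [integral_mul_prod (fun i => boltz d N V β (σ i)) A j
      fun i => integral_boltz d N V β _ (hZpos _).ne']
  have hj : ∀ j : Fin N, ∫ X : Fin N → Fin d → ℝ,
      A (X j) * occProb d N V β j k X * margDensity d N V β X =
        ∑ σ : Equiv.Perm (Fin N), if σ j = k then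
          (N.factorial : ℝ)⁻¹ * ∫ x, A x * boltz d N V β k x else 0 := by
    intro j
    simp only [mul_assoc, occProb_mul_margDensity d N V β h0, Finset.mul_sum]
    rw [integral_finsetSum]
    · refine Finset.sum_congr rfl fun σ _ => ?_
      split_ifs with h
      · rw [hval, h]
      · simp
    · intro σ _
      split_ifs
      · exact hterm j σ
      · simp
  simp only [hj]
  rw [Finset.sum_comm]
  have hσ : ∀ (σ : Equiv.Perm (Fin N)) (j : Fin N), σ j = k ↔ j = σ.symm k :=
    fun σ j => (Equiv.eq_symm_apply σ).symm
  simp only [hσ, Finset.sum_ite_eq', Finset.mem_univ, if_true, Finset.sum_const,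
    Finset.card_univ, Fintype.card_perm, Fintype.card_fin, nsmul_eq_mul]
  rw [mul_inv_cancel_left₀ (Nat.cast_ne_zero.mpr N.factorial_ne_zero)]
end

section
/- Assume V is twice continuously differentiable and let f : (ℝ^d)^N → ℝ be twice continuously differentiable. Then the adjoint of the averaged (infinite-swapping) generator has the explicit form: for every X ∈ (ℝ^d)^N, Σ_{σ∈S_N} Σ_{k=1}^N [ div_{x_k}( β⁻¹ β_{σ(k)} ∇V(x_k) ϱ(σ∣X) f(X) ) + β⁻¹ Δ_{x_k}( ϱ(σ∣X) f(X) ) ] = Σ_{k=1}^N [ div_{x_k}( R_k(X) ∇V(x_k) f(X) ) + β⁻¹ Δ_{x_k} f(X) ]. -/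
open Real Equiv Finset

/-- Gradient of a function on `ℝ^d` (as `Fin d → ℝ`), componentwise via `fderiv`. -/
noncomputable def grad (d : ℕ) (V : (Fin d → ℝ) → ℝ) (x : Fin d → ℝ) : Fin d → ℝ :=
  fun i => fderiv ℝ V x (Pi.single i 1)

/-- Partial derivative in the `i`-th coordinate of the `k`-th replica of a function on
configuration space `(ℝ^d)^N`. -/
noncomputable def pDeriv (d N : ℕ) (k : Fin N) (i : Fin d)
    (f : (Fin N → Fin d → ℝ) → ℝ) (X : Fin N → Fin d → ℝ) : ℝ :=
  fderiv ℝ f X (Pi.single k (Pi.single i 1))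

/-- Divergence with respect to the variables of the `k`-th replica of a vector field
`F : (ℝ^d)^N → ℝ^d`. -/
noncomputable def pDiv (d N : ℕ) (k : Fin N)
    (F : (Fin N → Fin d → ℝ) → Fin d → ℝ) (X : Fin N → Fin d → ℝ) : ℝ :=
  ∑ i : Fin d, pDeriv d N k i (fun Y => F Y i) X

/-- Laplacian with respect to the variables of the `k`-th replica. -/
noncomputable def pLap (d N : ℕ) (k : Fin N)
    (f : (Fin N → Fin d → ℝ) → ℝ) (X : Fin N → Fin d → ℝ) : ℝ :=
  ∑ i : Fin d, pDeriv d N k i (fun Y => pDeriv d N k i f Y) X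

/-- The drift-scaling factors `R_j(X) = β⁻¹ ∑_σ β_{σ(j)} ϱ(σ∣X)`. -/
noncomputable def driftFactor (d N : ℕ) [NeZero N] (V : (Fin d → ℝ) → ℝ) (β : Fin N → ℝ)
    (j : Fin N) (X : Fin N → Fin d → ℝ) : ℝ :=
  (β 0)⁻¹ * ∑ σ : Equiv.Perm (Fin N), β (σ j) * condWeight d N V β σ X

theorem pDeriv_sum {ι : Type*} (d N : ℕ) (k : Fin N) (i : Fin d) (s : Finset ι)
    (g : ι → (Fin N → Fin d → ℝ) → ℝ) (hg : ∀ a ∈ s, Differentiable ℝ (g a))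
    (X : Fin N → Fin d → ℝ) :
    pDeriv d N k i (fun Y => ∑ a ∈ s, g a Y) X = ∑ a ∈ s, pDeriv d N k i (g a) X := by
  simp only [pDeriv]
  rw [fderiv_fun_sum fun a ha => hg a ha X, _root_.sum_apply]

theorem pDiv_sum {ι : Type*} (d N : ℕ) (k : Fin N) (s : Finset ι)
    (F : ι → (Fin N → Fin d → ℝ) → Fin d → ℝ)
    (hF : ∀ a ∈ s, ∀ i, Differentiable ℝ fun Y => F a Y i) (X : Fin N → Fin d → ℝ) :
    pDiv d N k (fun Y i => ∑ a ∈ s, F a Y i) X = ∑ a ∈ s, pDiv d N k (F a) X := by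
  simp only [pDiv]
  rw [Finset.sum_comm]
  exact Finset.sum_congr rfl fun i _ =>
    pDeriv_sum d N k i s (fun a Y => F a Y i) (fun a ha => hF a ha i) X

theorem ContDiff.differentiable_pDeriv {d N : ℕ} {f : (Fin N → Fin d → ℝ) → ℝ}
    (hf : ContDiff ℝ 2 f) (k : Fin N) (i : Fin d) : Differentiable ℝ (pDeriv d N k i f) :=
  ((hf.fderiv_right (m := 1) (by norm_num)).differentiable one_ne_zero).clm_apply
    (differentiable_const _)

theorem ContDiff.differentiable_grad {d : ℕ} {V : (Fin d → ℝ) → ℝ}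
    (hV : ContDiff ℝ 2 V) (i : Fin d) : Differentiable ℝ fun x => grad d V x i :=
  ((hV.fderiv_right (m := 1) (by norm_num)).differentiable one_ne_zero).clm_apply
    (differentiable_const _)

theorem pLap_sum {ι : Type*} (d N : ℕ) (k : Fin N) (s : Finset ι)
    (g : ι → (Fin N → Fin d → ℝ) → ℝ) (hg : ∀ a ∈ s, ContDiff ℝ 2 (g a))
    (X : Fin N → Fin d → ℝ) :
    pLap d N k (fun Y => ∑ a ∈ s, g a Y) X = ∑ a ∈ s, pLap d N k (g a) X := by
  have h (i : Fin d) : (fun Y => pDeriv d N k i (fun Y => ∑ a ∈ s, g a Y) Y)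
      = fun Y => ∑ a ∈ s, pDeriv d N k i (g a) Y :=
    funext (pDeriv_sum d N k i s g fun a ha => (hg a ha).differentiable two_ne_zero)
  simp only [pLap]
  rw [Finset.sum_comm]
  refine Finset.sum_congr rfl fun i _ => ?_
  rw [h i]
  exact pDeriv_sum d N k i s _ (fun a ha => (hg a ha).differentiable_pDeriv k i) X

theorem sum_exp_permPotential_pos (d N : ℕ) [NeZero N] (V : (Fin d → ℝ) → ℝ) (β : Fin N → ℝ)
    (X : Fin N → Fin d → ℝ) :
    0 < ∑ σ : Equiv.Perm (Fin N), Real.exp (-(β 0) * permPotential d N V β X σ) :=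
  Finset.sum_pos (fun _ _ => Real.exp_pos _) Finset.univ_nonempty

theorem sum_condWeight (d N : ℕ) [NeZero N] (V : (Fin d → ℝ) → ℝ) (β : Fin N → ℝ)
    (X : Fin N → Fin d → ℝ) : ∑ σ : Equiv.Perm (Fin N), condWeight d N V β σ X = 1 := by
  simp only [condWeight]
  rw [← Finset.sum_div, div_self (sum_exp_permPotential_pos d N V β X).ne']

theorem ContDiff.condWeight {d N : ℕ} [NeZero N] {n : WithTop ℕ∞} {V : (Fin d → ℝ) → ℝ}
    (hV : ContDiff ℝ n V) (β : Fin N → ℝ) (σ : Equiv.Perm (Fin N)) :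
    ContDiff ℝ n (condWeight d N V β σ) := by
  have h (τ : Equiv.Perm (Fin N)) : ContDiff ℝ n fun X : Fin N → Fin d → ℝ =>
      Real.exp (-(β 0) * permPotential d N V β X τ) := by
    unfold permPotential
    exact (contDiff_const.mul (contDiff_const.mul (ContDiff.sum fun i _ =>
      contDiff_const.mul (hV.comp (contDiff_apply ℝ (Fin d → ℝ) i))))).exp
  exact (h σ).div (ContDiff.sum fun τ _ => h τ) fun X =>
    (sum_exp_permPotential_pos d N V β X).ne'

/-- explicit form of the adjoint of the averaged (infinite-swapping)
generator: for `V` and `f` twice continuously differentiable, and every `X`,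
`∑_σ ∑_k [ div_{x_k}(β⁻¹ β_{σ(k)} ∇V(x_k) ϱ(σ∣X) f(X)) + β⁻¹ Δ_{x_k}(ϱ(σ∣X) f(X)) ]
 = ∑_k [ div_{x_k}(R_k(X) ∇V(x_k) f(X)) + β⁻¹ Δ_{x_k} f(X) ]`. -/
theorem averaged_adjoint_generator_explicit
    (d N : ℕ) (hd : 1 ≤ d) [NeZero N]
    (V : (Fin d → ℝ) → ℝ) (hV : ContDiff ℝ 2 V)
    (β : Fin N → ℝ) (hβ : ∀ i, 0 < β i)
    (f : (Fin N → Fin d → ℝ) → ℝ) (hf : ContDiff ℝ 2 f) :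
    ∀ X : Fin N → Fin d → ℝ,
      (∑ σ : Equiv.Perm (Fin N), ∑ k : Fin N,
        (pDiv d N k
            (fun Y i => (β 0)⁻¹ * β (σ k) * grad d V (Y k) i * (condWeight d N V β σ Y * f Y)) X
          + (β 0)⁻¹ * pLap d N k (fun Y => condWeight d N V β σ Y * f Y) X))
      = ∑ k : Fin N,
          (pDiv d N k (fun Y i => driftFactor d N V β k Y * grad d V (Y k) i * f Y) X
            + (β 0)⁻¹ * pLap d N k f X) := by
  intro X
  have hw (σ : Equiv.Perm (Fin N)) : ContDiff ℝ 2 fun Y => condWeight d N V β σ Y * f Y :=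
    (hV.condWeight β σ).mul hf
  rw [Finset.sum_comm]
  refine Finset.sum_congr rfl fun k _ => ?_
  have hdrift : (fun (Y : Fin N → Fin d → ℝ) i =>
        driftFactor d N V β k Y * grad d V (Y k) i * f Y)
      = fun Y i => ∑ σ : Equiv.Perm (Fin N),
        (β 0)⁻¹ * β (σ k) * grad d V (Y k) i * (condWeight d N V β σ Y * f Y) := by
    funext Y i
    simp only [driftFactor, Finset.mul_sum, Finset.sum_mul]
    exact Finset.sum_congr rfl fun σ _ => by ring
  have hf_sum : f = fun Y => ∑ σ : Equiv.Perm (Fin N), condWeight d N V β σ Y * f Y := by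
    funext Y
    rw [← Finset.sum_mul, sum_condWeight, one_mul]
  have hdiv := pDiv_sum d N k Finset.univ
    (fun (σ : Equiv.Perm (Fin N)) Y i =>
      (β 0)⁻¹ * β (σ k) * grad d V (Y k) i * (condWeight d N V β σ Y * f Y))
    (fun σ _ i => (((hV.differentiable_grad i).comp (differentiable_apply k)).const_mul _).mul
      ((hw σ).differentiable two_ne_zero)) X
  have hlap := pLap_sum d N k Finset.univ
    (fun (σ : Equiv.Perm (Fin N)) Y => condWeight d N V β σ Y * f Y) (fun σ _ => hw σ) X
  rw [← hf_sum] at hlap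
  rw [Finset.sum_add_distrib, ← Finset.mul_sum, hdrift, hdiv, hlap]
end

section
/- Assume V is twice continuously differentiable. Then the (unnormalized) marginal density ρ(X) = Σ_{σ∈S_N} e^{−β𝒱(X,σ)} has identically vanishing probability flux for the infinite-swapping dynamics: for every X ∈ (ℝ^d)^N and every k ∈ {1,…,N}, R_k(X) ∇V(x_k) ρ(X) + β⁻¹ ∇_{x_k} ρ(X) = 0; consequently Σ_{k=1}^N div_{x_k}( R_k(X) ∇V(x_k) ρ(X) + β⁻¹ ∇_{x_k} ρ(X) ) = 0, i.e. ρ is a stationary density of the effective dynamics dx_j = −R_j(X)∇V(x_j) dt + √(2β⁻¹) dW_j obtained in the infinite swapping limit. -/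
open Real Equiv Finset

/-- The (unnormalized) marginal density `ρ(X) = ∑_σ e^{−β𝒱(X,σ)}`. -/
noncomputable def mixDensity (d N : ℕ) [NeZero N] (V : (Fin d → ℝ) → ℝ) (β : Fin N → ℝ)
    (X : Fin N → Fin d → ℝ) : ℝ :=
  ∑ σ : Equiv.Perm (Fin N), Real.exp (-(β 0) * permPotential d N V β X σ)

theorem hasFDerivAt_permPotential (d N : ℕ) [NeZero N] {V : (Fin d → ℝ) → ℝ}
    (hV : Differentiable ℝ V) (β : Fin N → ℝ) (X : Fin N → Fin d → ℝ)
    (σ : Equiv.Perm (Fin N)) :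
    HasFDerivAt (fun Y => permPotential d N V β Y σ)
      ((β 0)⁻¹ • ∑ j : Fin N, β (σ j) •
        (fderiv ℝ V (X j)).comp
          (ContinuousLinearMap.proj (R := ℝ) (φ := fun _ : Fin N => Fin d → ℝ) j))
      X := by
  unfold permPotential
  refine HasFDerivAt.const_mul (HasFDerivAt.fun_sum fun j _ => HasFDerivAt.const_mul ?_ _) _
  exact (hV (X j)).hasFDerivAt.comp X (hasFDerivAt_apply j X)

theorem pDeriv_mixDensity (d N : ℕ) [NeZero N] {V : (Fin d → ℝ) → ℝ}
    (hV : Differentiable ℝ V) (β : Fin N → ℝ) (hβ : β 0 ≠ 0) (X : Fin N → Fin d → ℝ)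
    (k : Fin N) (i : Fin d) :
    pDeriv d N k i (mixDensity d N V β) X =
      -((∑ σ : Equiv.Perm (Fin N), β (σ k) * Real.exp (-(β 0) * permPotential d N V β X σ))
        * grad d V (X k) i) := by
  have h : HasFDerivAt (mixDensity d N V β) _ X := HasFDerivAt.fun_sum fun σ _ =>
    ((hasFDerivAt_permPotential d N hV β X σ).const_mul (-(β 0))).exp
  rw [pDeriv, h.fderiv, Finset.sum_mul, ← Finset.sum_neg_distrib, _root_.sum_apply]
  refine Finset.sum_congr rfl fun σ _ => ?_
  have hsum : ∑ j : Fin N, β (σ j) *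
      fderiv ℝ V (X j) ((Pi.single k (Pi.single i 1) : Fin N → Fin d → ℝ) j)
        = β (σ k) * grad d V (X k) i := by
    rw [Finset.sum_eq_single k]
    · simp [grad]
    · intro j _ hj
      simp [hj]
    · simp
  simp only [_root_.smul_apply, _root_.sum_apply,
    ContinuousLinearMap.comp_apply, ContinuousLinearMap.proj_apply, smul_eq_mul, hsum]
  field_simp

theorem driftFactor_mul_mixDensity (d N : ℕ) [NeZero N] (V : (Fin d → ℝ) → ℝ)
    (β : Fin N → ℝ) (k : Fin N) (X : Fin N → Fin d → ℝ) :
    driftFactor d N V β k X * mixDensity d N V β X =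
      (β 0)⁻¹ * ∑ σ : Equiv.Perm (Fin N),
        β (σ k) * Real.exp (-(β 0) * permPotential d N V β X σ) := by
  have hpos : 0 < ∑ σ : Equiv.Perm (Fin N), Real.exp (-(β 0) * permPotential d N V β X σ) :=
    Finset.sum_pos (fun σ _ => Real.exp_pos _) Finset.univ_nonempty
  rw [driftFactor, mixDensity, mul_assoc, Finset.sum_mul]
  congr 1
  refine Finset.sum_congr rfl fun σ _ => ?_
  rw [condWeight, mul_assoc, div_mul_cancel₀ _ (ne_of_gt hpos)]

/-- the unnormalized marginal density `ρ(X) = ∑_σ e^{−β𝒱(X,σ)}` has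
identically vanishing probability flux for the infinite-swapping dynamics:
`R_k(X) ∇V(x_k) ρ(X) + β⁻¹ ∇_{x_k} ρ(X) = 0`, and consequently the total divergence of
the flux vanishes, i.e. `ρ` is a stationary density of the effective dynamics. -/
theorem mixDensity_zero_flux
    (d N : ℕ) (hd : 1 ≤ d) [NeZero N]
    (V : (Fin d → ℝ) → ℝ) (hV : ContDiff ℝ 2 V)
    (β : Fin N → ℝ) (hβ : ∀ i, 0 < β i) :
    (∀ (X : Fin N → Fin d → ℝ) (k : Fin N) (i : Fin d),
      driftFactor d N V β k X * grad d V (X k) i * mixDensity d N V β X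
        + (β 0)⁻¹ * pDeriv d N k i (mixDensity d N V β) X = 0)
    ∧ (∀ X : Fin N → Fin d → ℝ,
        ∑ k : Fin N, pDiv d N k
          (fun Y i => driftFactor d N V β k Y * grad d V (Y k) i * mixDensity d N V β Y
            + (β 0)⁻¹ * pDeriv d N k i (mixDensity d N V β) Y) X = 0) := by
  have flux : ∀ (X : Fin N → Fin d → ℝ) (k : Fin N) (i : Fin d),
      driftFactor d N V β k X * grad d V (X k) i * mixDensity d N V β X
        + (β 0)⁻¹ * pDeriv d N k i (mixDensity d N V β) X = 0 := by
    intro X k i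
    rw [pDeriv_mixDensity d N (hV.differentiable two_ne_zero) β (hβ 0).ne', mul_right_comm,
      driftFactor_mul_mixDensity]
    ring
  exact ⟨flux, fun X => by simp only [pDiv, flux]; simp [pDeriv]⟩
end
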